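/- arXiv:2211.09557 — 2 statements merged into one kernel-verified Lean document; each statement's English description precedes it below -/
import Mathlib

section
/- Let X be a real N×N matrix with strictly positive entries, ε ∈ (0,1), and α ∈ ℝ^N with strictly positive entries. Let c ∈ ℝ^N be defined entrywise by cₙ = 1/αₙ. Then the following are equivalent: (i) Xα ≤ (1−ε)·1 entrywise and αₙ·Σₘ Xₙₘ ≤ 1−ε for all n; (ii) cₙ ≥ (Σₘ Xₙₘ)/(1−ε) for all n, and there exists a ∈ ℝ^N with Xa ≤ (1−ε)·1 entrywise and aₙ·cₙ ≥ 1 for all n. -/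
open Matrix

theorem slope_constraints_equiv_inverse_slope {N : ℕ}
    (X : Matrix (Fin N) (Fin N) ℝ) (hX : ∀ n m, 0 < X n m)
    (ε : ℝ) (hε : ε ∈ Set.Ioo (0 : ℝ) 1)
    (α : Fin N → ℝ) (hα : ∀ n, 0 < α n)
    (c : Fin N → ℝ) (hc : ∀ n, c n = 1 / α n) :
    ((∀ n, X.mulVec α n ≤ 1 - ε) ∧ (∀ n, α n * ∑ m, X n m ≤ 1 - ε)) ↔
    ((∀ n, c n ≥ (∑ m, X n m) / (1 - ε)) ∧
      ∃ a : Fin N → ℝ, (∀ n, X.mulVec a n ≤ 1 - ε) ∧ (∀ n, a n * c n ≥ 1)) := by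
  have h1 : 0 < 1 - ε := by linarith [hε.2]
  have key : ∀ n, c n ≥ (∑ m, X n m) / (1 - ε) ↔ α n * ∑ m, X n m ≤ 1 - ε := by
    intro n
    rw [hc, ge_iff_le, div_le_div_iff₀ h1 (hα n), one_mul, mul_comm]
  constructor
  · rintro ⟨h, h'⟩
    refine ⟨fun n => (key n).2 (h' n), α, h, fun n => ?_⟩
    rw [hc, mul_one_div_cancel (hα n).ne']
  · rintro ⟨h, a, ha, hac⟩
    refine ⟨fun n => le_trans ?_ (ha n), fun n => (key n).1 (h n)⟩
    simp only [Matrix.mulVec, dotProduct]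
    refine Finset.sum_le_sum fun m _ => mul_le_mul_of_nonneg_left ?_ (hX n m).le
    have h2 := hac m
    rw [hc, mul_one_div, ge_iff_le, le_div_iff₀ (hα m), one_mul] at h2
    exact h2
end

section
/- Let X be a real symmetric positive definite N×N matrix, let α, q̄ ∈ ℝ^N have strictly positive entries with q̄ₙ = αₙ(σₙ − δₙ) where σₙ > δₙ ≥ 0, and let ṽ, v̄ ∈ ℝ^N. Define F(q) = ½ qᵀXq + qᵀ(ṽ − v̄) + Σₙ ( qₙ²/(2αₙ) + δₙ|qₙ| ). For each n, let fₙ be the Volt/VAR curve with parameters (v̄ₙ, δₙ, σₙ, αₙ): fₙ(v) = q̄ₙ for v < v̄ₙ − σₙ; fₙ(v) = −αₙ(v − v̄ₙ + δₙ) for v̄ₙ − σₙ ≤ v < v̄ₙ − δₙ; fₙ(v) = 0 for |v − v̄ₙ| ≤ δₙ; fₙ(v) = −αₙ(v − v̄ₙ − δₙ) for v̄ₙ + δₙ < v ≤ v̄ₙ + σₙ; fₙ(v) = −q̄ₙ for v > v̄ₙ + σₙ. Then a point q* ∈ [−q̄, q̄] is the minimizer of F over the box [−q̄, q̄] if and only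 if q*ₙ = fₙ((Xq* + ṽ)ₙ) for all n; i.e., the equilibria of the Volt/VAR dynamics are exactly the minimizers of F. -/
open Matrix

/-- The IEEE 1547 piecewise-linear Volt/VAR control curve with reference voltage `v̄`,
deadband half-width `δ`, saturation offset `σ`, slope `α`, and saturation value
`q̄ = α (σ - δ)`. -/
noncomputable def voltVarCurve (vbar δ σ α : ℝ) (v : ℝ) : ℝ :=
  if v < vbar - σ then α * (σ - δ)
  else if v < vbar - δ then -α * (v - vbar + δ)
  else if v ≤ vbar + δ then 0
  else if v ≤ vbar + σ then -α * (v - vbar - δ)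
  else -(α * (σ - δ))

lemma vv_mem (vbar δ σ α v : ℝ) (hα : 0 < α) (hσ : δ < σ) :
    -(α * (σ - δ)) ≤ voltVarCurve vbar δ σ α v ∧ voltVarCurve vbar δ σ α v ≤ α * (σ - δ) := by
  have h0 : 0 < α * (σ - δ) := mul_pos hα (by linarith)
  unfold voltVarCurve
  split_ifs with h1 h2 h3 h4
  · constructor <;> linarith
  · constructor <;> nlinarith
  · constructor <;> linarith
  · constructor <;> nlinarith
  · constructor <;> linarith

lemma vv_var (vbar δ σ α v : ℝ) (hα : 0 < α) (hδ : 0 ≤ δ) (hσ : δ < σ) (x : ℝ)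
    (hx1 : -(α * (σ - δ)) ≤ x) (hx2 : x ≤ α * (σ - δ)) (s : ℝ)
    (hs : s = voltVarCurve vbar δ σ α v) :
    (v - vbar) * s + s ^ 2 / (2 * α) + δ * |s| + (x - s) ^ 2 / (2 * α) ≤
      (v - vbar) * x + x ^ 2 / (2 * α) + δ * |x| := by
  have key : 0 ≤ (v - vbar + s / α) * (x - s) + δ * (|x| - |s|) := by
    have h0 : 0 < α * (σ - δ) := mul_pos hα (by linarith)
    have a1 : 0 ≤ δ * (|x| - x) := mul_nonneg hδ (by linarith [le_abs_self x])
    have a2 : 0 ≤ δ * (|x| + x) := mul_nonneg hδ (by linarith [neg_abs_le x])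
    unfold voltVarCurve at hs
    split_ifs at hs with h1 h2 h3 h4
    · have e : s / α = σ - δ := by rw [hs]; field_simp
      rw [e, abs_of_pos (by linarith : 0 < s)]
      have : 0 ≤ (-(v - vbar + σ)) * (s - x) := mul_nonneg (by linarith) (by linarith)
      nlinarith
    · have e : s / α = -(v - vbar + δ) := by rw [hs]; field_simp
      have hp : 0 ≤ s := by rw [hs]; nlinarith
      rw [e, abs_of_nonneg hp]
      nlinarith
    · have e : s / α = 0 := by rw [hs]; simp
      rw [e, hs, abs_zero]
      rcases abs_cases x with ⟨hh, hx⟩ | ⟨hh, hx⟩ <;> rw [hh] <;> nlinarith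
    · have e : s / α = -(v - vbar - δ) := by rw [hs]; field_simp
      have hp : s ≤ 0 := by rw [hs]; nlinarith
      rw [e, abs_of_nonpos hp]
      nlinarith
    · have e : s / α = -(σ - δ) := by rw [hs]; field_simp
      rw [e, abs_of_neg (by linarith : s < 0)]
      have : 0 ≤ (v - vbar - σ) * (x - s) := mul_nonneg (by linarith) (by linarith)
      nlinarith
  have e : (v - vbar) * x + x ^ 2 / (2 * α) + δ * |x| -
      ((v - vbar) * s + s ^ 2 / (2 * α) + δ * |s| + (x - s) ^ 2 / (2 * α)) =
      (v - vbar + s / α) * (x - s) + δ * (|x| - |s|) := by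
    field_simp
    ring
  linarith

/-- Expansion of the quadratic part. -/
lemma quad_expand {N : ℕ} (X : Matrix (Fin N) (Fin N) ℝ) (hXsymm : X.IsSymm)
    (q d w : Fin N → ℝ) :
    (1 / 2) * ((q + d) ⬝ᵥ X.mulVec (q + d)) + (q + d) ⬝ᵥ w =
      (1 / 2) * (q ⬝ᵥ X.mulVec q) + q ⬝ᵥ w + (1 / 2) * (d ⬝ᵥ X.mulVec d) +
        d ⬝ᵥ (X.mulVec q + w) := by
  have h : q ⬝ᵥ X.mulVec d = d ⬝ᵥ X.mulVec q := by
    rw [Matrix.dotProduct_mulVec, ← Matrix.mulVec_transpose, hXsymm.eq, dotProduct_comm]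
  simp only [Matrix.mulVec_add, add_dotProduct, dotProduct_add, h]
  ring

theorem equilibria_are_minimizers {N : ℕ}
    (X : Matrix (Fin N) (Fin N) ℝ) (hX : X.PosDef) (hXsymm : X.IsSymm)
    (α σ δ qbar : Fin N → ℝ) (hα : ∀ n, 0 < α n)
    (hδ : ∀ n, 0 ≤ δ n) (hσ : ∀ n, δ n < σ n)
    (hqbar : ∀ n, qbar n = α n * (σ n - δ n))
    (vtil vbar : Fin N → ℝ)
    (F : (Fin N → ℝ) → ℝ)
    (hF : ∀ q, F q = (1 / 2) * (q ⬝ᵥ X.mulVec q) + q ⬝ᵥ (vtil - vbar) +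
      ∑ n, ((q n) ^ 2 / (2 * α n) + δ n * |q n|))
    (qstar : Fin N → ℝ) (hbox : ∀ n, -qbar n ≤ qstar n ∧ qstar n ≤ qbar n) :
    (∀ q : Fin N → ℝ, (∀ n, -qbar n ≤ q n ∧ q n ≤ qbar n) → F qstar ≤ F q) ↔
    (∀ n, qstar n = voltVarCurve (vbar n) (δ n) (σ n) (α n) ((X.mulVec qstar + vtil) n)) := by
  have hexp : ∀ d : Fin N → ℝ, F (qstar + d) = F qstar + (1 / 2) * (d ⬝ᵥ X.mulVec d) +
      ∑ n, (((X.mulVec qstar + vtil) n - vbar n) * d n +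
        (((qstar n + d n) ^ 2 / (2 * α n) + δ n * |qstar n + d n|) -
          ((qstar n) ^ 2 / (2 * α n) + δ n * |qstar n|))) := by
    intro d
    rw [hF, hF, quad_expand X hXsymm, Finset.sum_add_distrib (f := fun n => _ * d n),
      Finset.sum_sub_distrib]
    have : d ⬝ᵥ (X.mulVec qstar + (vtil - vbar)) =
        ∑ n, ((X.mulVec qstar + vtil) n - vbar n) * d n := by
      unfold dotProduct
      refine Finset.sum_congr rfl fun n _ => ?_
      simp only [Pi.add_apply, Pi.sub_apply]
      ring
    rw [this]
    simp only [Pi.add_apply]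
    ring
  constructor
  · intro hmin n
    set v := (X.mulVec qstar + vtil) n with hv
    obtain ⟨s, hs⟩ : ∃ s, s = voltVarCurve (vbar n) (δ n) (σ n) (α n) v := ⟨_, rfl⟩
    have hsm := vv_mem (vbar n) (δ n) (σ n) (α n) v (hα n) (hσ n)
    rw [← hs, ← hqbar] at hsm
    rw [← hs]
    by_contra hne
    have hb := hbox n
    have hvar := vv_var (vbar n) (δ n) (σ n) (α n) v (hα n) (hδ n) (hσ n) (qstar n)
      (by rw [← hqbar]; exact hb.1) (by rw [← hqbar]; exact hb.2) s hs
    have hpos : 0 < X n n := hX.diag_pos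
    have ha := hα n
    have hD : 0 < 1 + α n * X n n := by positivity
    obtain ⟨ε, hε⟩ : ∃ ε, ε = 1 / (1 + α n * X n n) := ⟨_, rfl⟩
    have hε0 : 0 < ε := by rw [hε]; positivity
    have hεD : ε * (1 + α n * X n n) = 1 := by rw [hε]; field_simp
    have hε1 : ε ≤ 1 := by
      have : 0 < ε * (α n * X n n) := by positivity
      linarith
    have hm := hmin (qstar + Pi.single n (ε * (s - qstar n))) (by
      intro m
      by_cases hmn : m = n
      · subst hmn
        simp only [Pi.add_apply, Pi.single_eq_same]
        constructor <;> nlinarith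
      · simpa [hmn] using hbox m)
    rw [hexp, Finset.sum_eq_single n
      (by intro m _ hmn; simp [hmn]) (by simp)] at hm
    simp only [Pi.single_eq_same, Matrix.mulVec_single, single_dotProduct] at hm
    rw [← hv] at hm
    simp at hm
    have habs : |qstar n + ε * (s - qstar n)| ≤ (1 - ε) * |qstar n| + ε * |s| := by
      have e : qstar n + ε * (s - qstar n) = (1 - ε) * qstar n + ε * s := by ring
      rw [e]
      refine (abs_add_le _ _).trans ?_
      rw [abs_mul, abs_mul, abs_of_nonneg (by linarith : 0 ≤ 1 - ε), abs_of_pos hε0]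
    have h1 := mul_le_mul_of_nonneg_left habs (hδ n)
    have hsq : (qstar n + ε * (s - qstar n)) ^ 2 / (2 * α n) ≤
        (1 - ε) * (qstar n ^ 2 / (2 * α n)) + ε * (s ^ 2 / (2 * α n)) := by
      have e : (1 - ε) * (qstar n ^ 2 / (2 * α n)) + ε * (s ^ 2 / (2 * α n)) -
          (qstar n + ε * (s - qstar n)) ^ 2 / (2 * α n) =
          ε * (1 - ε) * (s - qstar n) ^ 2 / (2 * α n) := by
        field_simp
        ring
      have : 0 ≤ ε * (1 - ε) * (s - qstar n) ^ 2 / (2 * α n) := by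
        have : 0 ≤ 1 - ε := by linarith
        positivity
      linarith
    have h2 := mul_le_mul_of_nonneg_left hvar hε0.le
    have hd : 0 < (qstar n - s) ^ 2 := by
      have : qstar n - s ≠ 0 := sub_ne_zero.mpr hne
      positivity
    have h3 : ε * ((qstar n - s) ^ 2 / (2 * α n)) ≤
        1 / 2 * (X n n * ε ^ 2 * (qstar n - s) ^ 2) := by
      nlinarith
    have h4 : 1 / 2 * (X n n * ε ^ 2 * (qstar n - s) ^ 2) =
        ε * ((qstar n - s) ^ 2 / (2 * α n)) * (ε * (α n * X n n)) := by
      field_simp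
    have h5 : 0 < ε * ((qstar n - s) ^ 2 / (2 * α n)) := by positivity
    rw [h4] at h3
    nlinarith
  · intro heq q hq
    have e := hexp (q - qstar)
    rw [add_sub_cancel] at e
    rw [e]
    have hps : 0 ≤ (q - qstar) ⬝ᵥ X.mulVec (q - qstar) := by
      simpa using hX.posSemidef.dotProduct_mulVec_nonneg (q - qstar)
    have hsum : 0 ≤ ∑ n, (((X.mulVec qstar + vtil) n - vbar n) * (q - qstar) n +
        (((qstar n + (q - qstar) n) ^ 2 / (2 * α n) + δ n * |qstar n + (q - qstar) n|) -
          ((qstar n) ^ 2 / (2 * α n) + δ n * |qstar n|))) := by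
      refine Finset.sum_nonneg fun n _ => ?_
      have hvar := vv_var (vbar n) (δ n) (σ n) (α n) _ (hα n) (hδ n) (hσ n) (q n)
        (by rw [← hqbar]; exact (hq n).1) (by rw [← hqbar]; exact (hq n).2) _ (heq n)
      have hα' := hα n
      have : 0 ≤ (q n - qstar n) ^ 2 / (2 * α n) := by positivity
      have e2 : qstar n + (q - qstar) n = q n := by simp
      rw [e2, Pi.sub_apply, mul_sub]
      linarith
    linarith
end
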